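/- Under the even-case construction, for each i ∈ {1,...,k}, every injection f : {1,...,i} → {1,...,k} that minimizes Σ_{j=1}^i |r_j - (f(j)-1)| over all injections of {1,...,i} into {1,...,k} has image exactly {k/2 - ⌈i/2⌉ + 1, k/2 - ⌈i/2⌉ + 2, ..., k/2 + ⌊i/2⌋}. -/

import Mathlib

/-!
Even-case construction: k ≥ 2 even, 0 < ε ≤ 1.  Servers s_1,...,s_k at
positions 0,...,k-1 (s_i at position i-1).  ε_i = (ε/8)·2^(i-k) for i < k and
ε_k = 1/2.  Requests (1-indexed): for j = 1,...,k/2,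
r_{2j-1} = (k/2 + j - 1) - 1/2 - ε_{2j-1},  r_{2j} = (k/2 - j) - 1/2 + ε_{2j}.
A matching is a function f : ℕ → ℕ sending each request index i ∈ {1,...,k} to
a server index f i ∈ {1,...,k} (at position f i - 1); its cost is
C(f) = ∑_{i=1}^k |r_i - (f i - 1)|.
-/

/-- `ε_i`: equals `(ε/8)·2^(i-k)` for `i < k` and `1/2` for `i = k`. -/
noncomputable def eps (k : ℕ) (ε : ℝ) (i : ℕ) : ℝ :=
  if i = k then 1 / 2 else ε / 8 * (2 : ℝ) ^ ((i : ℤ) - (k : ℤ))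

/-- The request `r_i` (1-indexed, `1 ≤ i ≤ k`): writing `i = 2j-1` or `i = 2j`,
`r_{2j-1} = (k/2 + j - 1) - 1/2 - ε_{2j-1}` and `r_{2j} = (k/2 - j) - 1/2 + ε_{2j}`. -/
noncomputable def req (k : ℕ) (ε : ℝ) (i : ℕ) : ℝ :=
  if i % 2 = 1 then ((k : ℝ) / 2 + (((i + 1) / 2 : ℕ) : ℝ) - 1) - 1 / 2 - eps k ε i
  else ((k : ℝ) / 2 - ((i / 2 : ℕ) : ℝ)) - 1 / 2 + eps k ε i

/-- Cost of the matching sending request `i` to server `f i` (position `f i - 1`). -/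
noncomputable def cost (k : ℕ) (ε : ℝ) (f : ℕ → ℕ) : ℝ :=
  ∑ i ∈ Finset.Icc 1 k, |req k ε i - ((f i : ℝ) - 1)|

/-- The permutation algorithm's matching `π_A`:
`π_A(2j-1) = k/2 - j + 1`, `π_A(2j) = k/2 + j`. -/
def piA (k : ℕ) (i : ℕ) : ℕ :=
  if i % 2 = 1 then k / 2 - (i + 1) / 2 + 1 else k / 2 + i / 2

/-- The offline matching `π_B`: `π_B(2j-1) = k/2 + j`, `π_B(2j) = k/2 - j + 1`. -/
def piB (k : ℕ) (i : ℕ) : ℕ :=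
  if i % 2 = 1 then k / 2 + (i + 1) / 2 else k / 2 - i / 2 + 1

/-- The request index `j` with `piB k j = c`. -/
def piBInv (k c : ℕ) : ℕ :=
  if c ≤ k / 2 then 2 * (k / 2 - c) + 2 else 2 * (c - k / 2) - 1

lemma piB_piBInv {k c : ℕ} (hc : 1 ≤ c) : piB k (piBInv k c) = c := by
  unfold piB piBInv
  split_ifs <;> omega

lemma piBInv_piB {k j : ℕ} (hj : 1 ≤ j) (hjk : j ≤ k) : piBInv k (piB k j) = j := by
  unfold piB piBInv
  split_ifs <;> omega

lemma piB_mem_Icc {k i j : ℕ} (hj : 1 ≤ j) (hji : j ≤ i) (hik : i < k) :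
    k / 2 - i / 2 + 1 ≤ piB k j ∧ piB k j ≤ k / 2 + (i + 1) / 2 := by
  unfold piB
  split_ifs <;> omega

lemma piBInv_mem_Icc {k i c : ℕ} (hik : i < k) (hl : k / 2 - i / 2 + 1 ≤ c)
    (hu : c ≤ k / 2 + (i + 1) / 2) : 1 ≤ piBInv k c ∧ piBInv k c ≤ i := by
  unfold piBInv
  split_ifs <;> omega

lemma eps_of_lt {k i : ℕ} (ε : ℝ) (h : i < k) :
    eps k ε i = ε / 8 * (2 : ℝ) ^ ((i : ℤ) - (k : ℤ)) := by
  simp [eps, h.ne]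

lemma eps_pos {k i : ℕ} {ε : ℝ} (hε : 0 < ε) (h : i < k) : 0 < eps k ε i := by
  rw [eps_of_lt ε h]
  positivity

lemma eps_le {k i : ℕ} {ε : ℝ} (hε1 : ε ≤ 1) (h : i < k) :
    eps k ε i ≤ 1 / 16 := by
  rw [eps_of_lt ε h]
  have h2 : (2 : ℝ) ^ ((i : ℤ) - (k : ℤ)) ≤ (2 : ℝ) ^ (-1 : ℤ) :=
    zpow_le_zpow_right₀ (by norm_num) (by omega)
  have h3 : (2 : ℝ) ^ (-1 : ℤ) = 1 / 2 := by norm_num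
  rw [h3] at h2
  calc ε / 8 * (2 : ℝ) ^ ((i : ℤ) - (k : ℤ)) ≤ 1 / 8 * (1 / 2) := by gcongr
    _ = 1 / 16 := by norm_num

lemma sum_eps_lt {k i : ℕ} {ε : ℝ} (hε : 0 < ε) (h : i < k) :
    ∑ j ∈ Finset.Icc 1 i, eps k ε j < 2 * eps k ε i := by
  induction i with
  | zero => simpa using eps_pos hε h
  | succ n ih =>
    have hn := ih (by omega)
    have hs : eps k ε (n + 1) = 2 * eps k ε n := by
      rw [eps_of_lt ε h, eps_of_lt ε (by omega : n < k)]
      have : ((n + 1 : ℕ) : ℤ) - (k : ℤ) = ((n : ℤ) - k) + 1 := by push_cast; ring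
      rw [this, zpow_add_one₀ (by norm_num)]
      ring
    rw [Finset.sum_Icc_succ_top (by omega)]
    linarith

/-- Each request lies within `eps` of the midpoint between the servers `piB k j - 1` and
`piB k j`, on the side of the server of index `piB k j - j % 2`. -/
lemma req_eq {k j : ℕ} (ε : ℝ) (hk : Even k) (hjk : j ≤ k) :
    req k ε j = (piB k j : ℝ) - 3 / 2 + (if j % 2 = 1 then -eps k ε j else eps k ε j) := by
  obtain ⟨m, rfl⟩ := hk
  have hm : (m + m) / 2 = m := by omega
  unfold req piB
  rw [hm]
  split_ifs
  · push_cast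
    ring
  · rw [Nat.cast_add (m - j / 2) 1, Nat.cast_sub (by omega : j / 2 ≤ m)]
    push_cast
    ring

lemma half_sub_eps_le {k j : ℕ} {ε : ℝ} (hk : Even k) (hjk : j ≤ k)
    (h0 : 0 ≤ eps k ε j) (s : ℕ) :
    1 / 2 - eps k ε j ≤ |req k ε j - ((s : ℝ) - 1)| := by
  rw [req_eq ε hk hjk, le_abs]
  rcases le_or_gt (piB k j) s with h | h
  · have : (piB k j : ℝ) ≤ s := by exact_mod_cast h
    right
    split_ifs <;> linarith
  · have : (s : ℝ) + 1 ≤ piB k j := by exact_mod_cast h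
    left
    split_ifs <;> linarith

lemma abs_req_sub_le {k j s : ℕ} {ε : ℝ} (hk : Even k) (hjk : j ≤ k)
    (h0 : 0 ≤ eps k ε j) (hs : s = piB k j ∨ s + 1 = piB k j) :
    |req k ε j - ((s : ℝ) - 1)| ≤ 1 / 2 + eps k ε j := by
  rw [req_eq ε hk hjk, abs_le]
  rcases hs with h | h
  · have : (s : ℝ) = piB k j := by exact_mod_cast h
    constructor <;> split_ifs <;> linarith
  · have : (s : ℝ) + 1 = piB k j := by exact_mod_cast h
    constructor <;> split_ifs <;> linarith

lemma abs_req_sub_nearest_le {k j s : ℕ} {ε : ℝ} (hk : Even k) (hjk : j ≤ k)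
    (h1 : eps k ε j ≤ 1 / 16) (hs : s + j % 2 = piB k j) :
    |req k ε j - ((s : ℝ) - 1)| ≤ 1 / 2 - eps k ε j := by
  have hs' : (s : ℝ) + (j % 2 : ℕ) = piB k j := by exact_mod_cast hs
  rw [req_eq ε hk hjk, abs_le]
  rcases Nat.mod_two_eq_zero_or_one j with h | h <;> rw [h] at hs' <;> push_cast at hs' <;>
    simp only [h, zero_ne_one, if_true, if_false] <;> constructor <;> linarith

lemma eq_piB_or_of_abs_req_sub_lt {k j s : ℕ} {ε : ℝ} (hk : Even k) (hjk : j ≤ k)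
    (h0 : 0 ≤ eps k ε j) (h1 : eps k ε j ≤ 1 / 16)
    (hs : |req k ε j - ((s : ℝ) - 1)| < 1) : s = piB k j ∨ s + 1 = piB k j := by
  rw [req_eq ε hk hjk, abs_lt] at hs
  by_contra! hne
  rcases (by omega : piB k j + 1 ≤ s ∨ s + 2 ≤ piB k j) with h | h
  · have : (piB k j : ℝ) + 1 ≤ s := by exact_mod_cast h
    split_ifs at hs <;> linarith
  · have : (s : ℝ) + 2 ≤ piB k j := by exact_mod_cast h
    split_ifs at hs <;> linarith

lemma eq_nearest_of_abs_req_sub_lt {k j s : ℕ} {ε : ℝ} (hk : Even k) (hjk : j ≤ k)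
    (h0 : 0 ≤ eps k ε j) (h1 : eps k ε j ≤ 1 / 16)
    (hs : |req k ε j - ((s : ℝ) - 1)| < 1 / 2 + eps k ε j) : s + j % 2 = piB k j := by
  have hc := eq_piB_or_of_abs_req_sub_lt hk hjk h0 h1 (by linarith)
  rw [req_eq ε hk hjk, abs_lt] at hs
  rcases hc with h | h
  · have : (s : ℝ) = piB k j := by exact_mod_cast h
    split_ifs at hs
    · linarith
    · omega
  · have : (s : ℝ) + 1 = piB k j := by exact_mod_cast h
    split_ifs at hs
    · omega
    · linarith

lemma eq_self_of_injOn_of_left {F : ℕ → ℕ} {L R : ℕ} (hF : Set.InjOn F (Set.Icc L R))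
    (h : ∀ c ∈ Set.Icc L R, F c = c ∨ F c + 1 = c) (hL : F L = L) :
    ∀ c ∈ Set.Icc L R, F c = c := by
  rintro c ⟨hLc, hcR⟩
  induction c, hLc using Nat.le_induction with
  | base => exact hL
  | succ n hn ih =>
    have hprev := ih (by omega)
    refine (h (n + 1) ⟨by omega, hcR⟩).resolve_right fun hc => ?_
    have := hF (x₁ := n) ⟨hn, by omega⟩ (x₂ := n + 1) ⟨by omega, hcR⟩ (by omega)
    omega

lemma add_one_eq_self_of_injOn_of_right {F : ℕ → ℕ} {L R : ℕ}
    (hF : Set.InjOn F (Set.Icc L R))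
    (h : ∀ c ∈ Set.Icc L R, F c = c ∨ F c + 1 = c) (hR : F R + 1 = R) :
    ∀ c ∈ Set.Icc L R, F c + 1 = c := by
  rintro c ⟨hLc, hcR⟩
  induction hcR using Nat.decreasingInduction with
  | self => exact hR
  | of_succ n hn ih =>
    have hnext := ih (by omega)
    refine (h n ⟨hLc, by omega⟩).resolve_left fun hc => ?_
    have := hF (x₁ := n) ⟨hLc, by omega⟩ (x₂ := n + 1) ⟨by omega, hn⟩ (by omega)
    omega

lemma excess_lt {k i : ℕ} {ε : ℝ} (hke : Even k) (hε : 0 < ε) (hε1 : ε ≤ 1)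
    (hi : 1 ≤ i) (hik : i < k) {f g : ℕ → ℕ}
    (hg : ∀ j ∈ Set.Icc 1 i, g j + i % 2 = piB k j)
    (hfg : ∑ j ∈ Finset.Icc 1 i, |req k ε j - ((f j : ℝ) - 1)| ≤
      ∑ j ∈ Finset.Icc 1 i, |req k ε j - ((g j : ℝ) - 1)|) {j : ℕ} (hj : j ∈ Set.Icc 1 i) :
    |req k ε j - ((f j : ℝ) - 1)| < 1 / 2 - eps k ε j + 2 * eps k ε i := by
  have hlower : |req k ε j - ((f j : ℝ) - 1)| - (1 / 2 - eps k ε j) ≤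
      ∑ l ∈ Finset.Icc 1 i, (|req k ε l - ((f l : ℝ) - 1)| - (1 / 2 - eps k ε l)) := by
    refine Finset.single_le_sum
      (f := fun l => |req k ε l - ((f l : ℝ) - 1)| - (1 / 2 - eps k ε l))
      (fun l hl => ?_) (Finset.mem_Icc.2 hj)
    have hlk : l < k := (Finset.mem_Icc.1 hl).2.trans_lt hik
    exact sub_nonneg.2
      (half_sub_eps_le hke hlk.le (eps_pos hε hlk).le _)
  have hupper : ∑ l ∈ Finset.Icc 1 i, (|req k ε l - ((g l : ℝ) - 1)| - (1 / 2 - eps k ε l)) ≤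
      ∑ l ∈ Finset.Icc 1 i, (2 * eps k ε l - if l = i then 2 * eps k ε i else 0) := by
    refine Finset.sum_le_sum fun l hl => ?_
    have hl' := Finset.mem_Icc.1 hl
    have hlk : l < k := hl'.2.trans_lt hik
    split_ifs with hli
    · subst hli
      linarith [abs_req_sub_nearest_le hke hlk.le (eps_le hε1 hlk) (hg l hl')]
    · have := hg l hl'
      linarith [abs_req_sub_le hke hlk.le (eps_pos hε hlk).le
        (by omega : g l = piB k l ∨ g l + 1 = piB k l)]
  rw [Finset.sum_sub_distrib] at hlower
  rw [Finset.sum_sub_distrib _ (fun l => 1 / 2 - eps k ε l),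
    Finset.sum_sub_distrib (fun l => 2 * eps k ε l), Finset.sum_ite_eq',
    if_pos (Finset.mem_Icc.2 ⟨hi, le_rfl⟩),
    ← Finset.mul_sum] at hupper
  linarith [sum_eps_lt hε hik]

/-- Even case: for each i ∈ {1,...,k}, every injection f : {1,...,i} → {1,...,k}
minimizing ∑_{j=1}^i |r_j - (f j - 1)| has image exactly
{k/2 - ⌈i/2⌉ + 1, ..., k/2 + ⌊i/2⌋}. -/
theorem even_opt_prefix_image (k : ℕ) (hk : 2 ≤ k) (hke : Even k)
    (ε : ℝ) (hε : 0 < ε) (hε1 : ε ≤ 1)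
    (i : ℕ) (hi : 1 ≤ i) (hik : i ≤ k)
    (f : ℕ → ℕ) (hmap : Set.MapsTo f (Set.Icc 1 i) (Set.Icc 1 k))
    (hinj : Set.InjOn f (Set.Icc 1 i))
    (hopt : ∀ f' : ℕ → ℕ, Set.MapsTo f' (Set.Icc 1 i) (Set.Icc 1 k) →
      Set.InjOn f' (Set.Icc 1 i) →
      ∑ j ∈ Finset.Icc 1 i, |req k ε j - ((f j : ℝ) - 1)| ≤
        ∑ j ∈ Finset.Icc 1 i, |req k ε j - ((f' j : ℝ) - 1)|) :
    f '' Set.Icc 1 i = Set.Icc (k / 2 - (i + 1) / 2 + 1) (k / 2 + i / 2) := by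
  have hcard : (f '' Set.Icc 1 i).ncard = i := by
    rw [hinj.ncard_image, Set.ncard_eq_toFinset_card']
    simp
  refine Set.eq_of_subset_of_ncard_le ?_ ?_ (Set.finite_Icc _ _)
  swap
  · rw [hcard, Set.ncard_eq_toFinset_card']
    simp only [Set.toFinset_Icc, Nat.card_Icc]
    omega
  rcases hik.eq_or_lt with rfl | hik
  · rintro _ ⟨j, hj, rfl⟩
    have := hmap hj
    obtain ⟨m, rfl⟩ := hke
    simp only [Set.mem_Icc] at this ⊢
    omega
  have hg : ∀ j ∈ Set.Icc 1 i, (piB k j - i % 2) + i % 2 = piB k j := fun j hj => by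
    have := piB_mem_Icc hj.1 hj.2 hik
    omega
  have hfg := hopt (fun j => piB k j - i % 2)
    (fun j hj => by
      have := piB_mem_Icc hj.1 hj.2 hik
      simp only [Set.mem_Icc]
      obtain ⟨m, rfl⟩ := hke
      omega)
    (fun a ha b hb hab => by
      have hab' : piB k a = piB k b := by
        rw [← hg a ha, ← hg b hb]
        exact congrArg (· + i % 2) hab
      rw [← piBInv_piB ha.1 (ha.2.trans hik.le), hab',
        piBInv_piB hb.1 (hb.2.trans hik.le)])
  have hnear : ∀ j ∈ Set.Icc 1 i, f j = piB k j ∨ f j + 1 = piB k j := fun j hj => by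
    have hjk : j < k := hj.2.trans_lt hik
    have h0 := eps_pos hε hjk
    refine eq_piB_or_of_abs_req_sub_lt hke hjk.le h0.le (eps_le hε1 hjk) ?_
    linarith [excess_lt hke hε hε1 hi hik hg hfg hj, eps_le hε1 hik]
  have hlast : f i + i % 2 = piB k i := by
    refine eq_nearest_of_abs_req_sub_lt hke hik.le (eps_pos hε hik).le (eps_le hε1 hik) ?_
    linarith [excess_lt hke hε hε1 hi hik hg hfg (j := i) ⟨hi, le_rfl⟩]
  have hinv : ∀ c ∈ Set.Icc (k / 2 - i / 2 + 1) (k / 2 + (i + 1) / 2),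
      piBInv k c ∈ Set.Icc 1 i := fun c hc => piBInv_mem_Icc hik hc.1 hc.2
  have hFinj : Set.InjOn (fun c => f (piBInv k c))
      (Set.Icc (k / 2 - i / 2 + 1) (k / 2 + (i + 1) / 2)) := fun a ha b hb hab => by
    have := hinj (hinv a ha) (hinv b hb) hab
    rw [← piB_piBInv (k := k) (by have := ha.1; omega : 1 ≤ a), this,
      piB_piBInv (by have := hb.1; omega)]
  have hFnear : ∀ c ∈ Set.Icc (k / 2 - i / 2 + 1) (k / 2 + (i + 1) / 2),
      f (piBInv k c) = c ∨ f (piBInv k c) + 1 = c := fun c hc => by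
    have := hnear _ (hinv c hc)
    rwa [piB_piBInv (by have := hc.1; omega)] at this
  rintro _ ⟨j, hj, rfl⟩
  have hmem := piB_mem_Icc hj.1 hj.2 hik
  have hj' := piBInv_piB hj.1 (hj.2.trans hik.le)
  have hi' := piBInv_piB hi hik.le
  rcases Nat.mod_two_eq_zero_or_one i with hpar | hpar
  · have hLi : piB k i = k / 2 - i / 2 + 1 := by simp [piB, hpar]
    have := eq_self_of_injOn_of_left hFinj hFnear
      (by simp only [← hLi, hi']; omega) (piB k j) hmem
    simp only [hj'] at this
    simp only [Set.mem_Icc]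
    omega
  · have hRi : piB k i = k / 2 + (i + 1) / 2 := by simp [piB, hpar]
    have := add_one_eq_self_of_injOn_of_right hFinj hFnear
      (by simp only [← hRi, hi']; omega) (piB k j) hmem
    simp only [hj'] at this
    simp only [Set.mem_Icc]
    obtain ⟨m, rfl⟩ := hke
    omega
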